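/- For every two-dimensional lattice L of co-volume 1 such that L is not the image of A₂ under an orthogonal transformation of ℝ², one has ζ_L(12) − ζ_{A₂}(12) > 2·(ζ_L(6) − ζ_{A₂}(6)); that is, Q_{12,6}(L) > 2. -/

import Mathlib

noncomputable section

/-- A point of the Euclidean plane with coordinates `a`, `b`. -/
def vec2 (a b : ℝ) : EuclideanSpace ℝ (Fin 2) := (WithLp.equiv 2 (Fin 2 → ℝ)).symm ![a, b]

/-- The lattice (as a set of points) generated by `u` and `v`. -/
def latticeSet (u v : EuclideanSpace ℝ (Fin 2)) : Set (EuclideanSpace ℝ (Fin 2)) :=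
  {p | ∃ m n : ℤ, p = (m : ℝ) • u + (n : ℝ) • v}

/-- The determinant of the pair of plane vectors `(u, v)`. -/
def det2 (u v : EuclideanSpace ℝ (Fin 2)) : ℝ := u 0 * v 1 - u 1 * v 0

/-- `L` is a two-dimensional lattice, i.e. `L = ℤu ⊕ ℤv` for a basis `(u,v)` of ℝ². -/
def IsLattice2 (L : Set (EuclideanSpace ℝ (Fin 2))) : Prop :=
  ∃ u v : EuclideanSpace ℝ (Fin 2), det2 u v ≠ 0 ∧ L = latticeSet u v

/-- `L` is a two-dimensional lattice of co-volume `V = |det(u,v)|`. -/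
def IsLattice2OfCovol (L : Set (EuclideanSpace ℝ (Fin 2))) (V : ℝ) : Prop :=
  ∃ u v : EuclideanSpace ℝ (Fin 2), det2 u v ≠ 0 ∧ |det2 u v| = V ∧ L = latticeSet u v

/-- The Epstein zeta function of a set of points: `ζ_L(s) = Σ'_{p ∈ L, p ≠ 0} |p|^{-s}`. -/
def epsteinZeta (L : Set (EuclideanSpace ℝ (Fin 2))) (s : ℝ) : ℝ :=
  ∑' p : ↥(L \ {0}), ‖(p : EuclideanSpace ℝ (Fin 2))‖ ^ (-s)

/-- The Lennard-Jones type energy `E_f[L] = Σ'_{p ∈ L, p ≠ 0} (a|p|^{-α} - b|p|^{-β})`. -/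
def LJenergy (a b α β : ℝ) (L : Set (EuclideanSpace ℝ (Fin 2))) : ℝ :=
  ∑' p : ↥(L \ {0}),
    (a * ‖(p : EuclideanSpace ℝ (Fin 2))‖ ^ (-α) - b * ‖(p : EuclideanSpace ℝ (Fin 2))‖ ^ (-β))

/-- The triangular lattice `A₂ = √(2/√3)·[ℤ(1,0) ⊕ ℤ(1/2,√3/2)]`, of co-volume 1. -/
def triangularLattice : Set (EuclideanSpace ℝ (Fin 2)) :=
  latticeSet (Real.sqrt (2 / Real.sqrt 3) • vec2 1 0)
    (Real.sqrt (2 / Real.sqrt 3) • vec2 (1 / 2) (Real.sqrt 3 / 2))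

/-- The square lattice `ℤ² = ℤ(1,0) ⊕ ℤ(0,1)`. -/
def squareLattice : Set (EuclideanSpace ℝ (Fin 2)) := latticeSet (vec2 1 0) (vec2 0 1)

/-- `L` is the image of `L'` under an orthogonal transformation of ℝ². -/
def IsRotationOf (L L' : Set (EuclideanSpace ℝ (Fin 2))) : Prop :=
  ∃ O : EuclideanSpace ℝ (Fin 2) ≃ₗᵢ[ℝ] EuclideanSpace ℝ (Fin 2), L = O '' L'

/-- The unit co-volume lattice parametrized by `(x, y)` in the half-fundamental domain:
`ℤu ⊕ ℤv` with `u = (1/√y, 0)` and `v = (x/√y, √y)`. -/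
def latticeXY (x y : ℝ) : Set (EuclideanSpace ℝ (Fin 2)) :=
  latticeSet (vec2 (1 / Real.sqrt y) 0) (vec2 (x / Real.sqrt y) (Real.sqrt y))

/-- The Riemann zeta function `ζ(s) = Σ_{m ≥ 1} m^{-s}` (real variable version). -/
def riemannZetaReal (s : ℝ) : ℝ := ∑' n : ℕ+, (n : ℝ) ^ (-s)

end

/-- Hermite interpolation with remainder of `ρ⁻³` at the double node `n` and the simple node `s`. -/
lemma inv_pow_three_hermite {n s ρ : ℝ} (hn : n ≠ 0) (hs : s ≠ 0) (hρ : ρ ≠ 0) :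
    ρ⁻¹ ^ 3 = n⁻¹ ^ 3 - 3 * n⁻¹ ^ 4 * (ρ - n)
      + n⁻¹ ^ 2 * s⁻¹ * (3 * n⁻¹ ^ 2 + 2 * n⁻¹ * s⁻¹ + s⁻¹ ^ 2) * (ρ - n) ^ 2
      - (ρ - n) ^ 2 * (ρ - s) * (n⁻¹ ^ 2 * s⁻¹ * ρ⁻¹) *
        (3 * n⁻¹ ^ 2 + 2 * n⁻¹ * (s⁻¹ + ρ⁻¹) + (s⁻¹ ^ 2 + s⁻¹ * ρ⁻¹ + ρ⁻¹ ^ 2)) := by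
  field_simp
  ring

/-- Hermite interpolation with remainder of `ρ⁻⁶` at the double node `n` and the simple node `s`. -/
lemma inv_pow_six_hermite {n s ρ : ℝ} (hn : n ≠ 0) (hs : s ≠ 0) (hρ : ρ ≠ 0) :
    ρ⁻¹ ^ 6 = n⁻¹ ^ 6 - 6 * n⁻¹ ^ 7 * (ρ - n)
      + n⁻¹ ^ 2 * s⁻¹ * (6 * n⁻¹ ^ 5 + 5 * n⁻¹ ^ 4 * s⁻¹ + 4 * n⁻¹ ^ 3 * s⁻¹ ^ 2
        + 3 * n⁻¹ ^ 2 * s⁻¹ ^ 3 + 2 * n⁻¹ * s⁻¹ ^ 4 + s⁻¹ ^ 5) * (ρ - n) ^ 2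
      - (ρ - n) ^ 2 * (ρ - s) * (n⁻¹ ^ 2 * s⁻¹ * ρ⁻¹) *
        (6 * n⁻¹ ^ 5 + 5 * n⁻¹ ^ 4 * (s⁻¹ + ρ⁻¹)
          + 4 * n⁻¹ ^ 3 * (s⁻¹ ^ 2 + s⁻¹ * ρ⁻¹ + ρ⁻¹ ^ 2)
          + 3 * n⁻¹ ^ 2 * (s⁻¹ ^ 3 + s⁻¹ ^ 2 * ρ⁻¹ + s⁻¹ * ρ⁻¹ ^ 2 + ρ⁻¹ ^ 3)
          + 2 * n⁻¹ * (s⁻¹ ^ 4 + s⁻¹ ^ 3 * ρ⁻¹ + s⁻¹ ^ 2 * ρ⁻¹ ^ 2 + s⁻¹ * ρ⁻¹ ^ 3 + ρ⁻¹ ^ 4)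
          + (s⁻¹ ^ 5 + s⁻¹ ^ 4 * ρ⁻¹ + s⁻¹ ^ 3 * ρ⁻¹ ^ 2 + s⁻¹ ^ 2 * ρ⁻¹ ^ 3
            + s⁻¹ * ρ⁻¹ ^ 4 + ρ⁻¹ ^ 5)) := by
  field_simp
  ring

lemma sum_inv_cube_le {n s a b c : ℝ} (hn : 0 < n) (hs : 0 < s)
    (ha : s ≤ a) (hb : s ≤ b) (hc : s ≤ c) (h1 : a + b + c = s + 2 * n)
    (h2 : a ^ 2 + b ^ 2 + c ^ 2 = s ^ 2 + 2 * n ^ 2) :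
    a⁻¹ ^ 3 + b⁻¹ ^ 3 + c⁻¹ ^ 3 ≤ s⁻¹ ^ 3 + 2 * n⁻¹ ^ 3 := by
  set K := n⁻¹ ^ 2 * s⁻¹ * (3 * n⁻¹ ^ 2 + 2 * n⁻¹ * s⁻¹ + s⁻¹ ^ 2) with hK
  have key : ∀ ρ, s ≤ ρ → ρ⁻¹ ^ 3 ≤ n⁻¹ ^ 3 - 3 * n⁻¹ ^ 4 * (ρ - n) + K * (ρ - n) ^ 2 := by
    intro ρ h
    have hρ : 0 < ρ := hs.trans_le h
    rw [inv_pow_three_hermite hn.ne' hs.ne' hρ.ne']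
    have : 0 ≤ ρ - s := by linarith
    have := inv_pos.2 hn
    have := inv_pos.2 hs
    have := inv_pos.2 hρ
    rw [← hK, sub_le_self_iff]
    positivity
  have es : s⁻¹ ^ 3 = n⁻¹ ^ 3 - 3 * n⁻¹ ^ 4 * (s - n) + K * (s - n) ^ 2 := by
    rw [inv_pow_three_hermite hn.ne' hs.ne' hs.ne', ← hK]
    ring
  have := key a ha
  have := key b hb
  have := key c hc
  have : (n⁻¹ ^ 3 - 3 * n⁻¹ ^ 4 * (a - n) + K * (a - n) ^ 2)
      + (n⁻¹ ^ 3 - 3 * n⁻¹ ^ 4 * (b - n) + K * (b - n) ^ 2)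
      + (n⁻¹ ^ 3 - 3 * n⁻¹ ^ 4 * (c - n) + K * (c - n) ^ 2) = s⁻¹ ^ 3 + 2 * n⁻¹ ^ 3 := by
    rw [es]
    linear_combination (-3 * n⁻¹ ^ 4 - 2 * K * n) * h1 + K * h2
  linarith

/-- The one-particle Lennard-Jones type potential with coupling `κ`, in normalised units. -/
noncomputable def ljPotential (κ ρ : ℝ) : ℝ := ρ⁻¹ ^ 6 - κ * ρ⁻¹ ^ 3

lemma hermite_remainder_nonneg {κ ν μ x : ℝ} (hκ : κ ≤ 3.08) (hx : μ ≤ x)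
    (hνμ : (1 ≤ ν ∧ 5 / 7 ≤ μ) ∨ (112 / 100 ≤ ν ∧ 4 / 7 ≤ μ)) :
    0 ≤ (6 * ν ^ 5 + 5 * ν ^ 4 * (μ + x) + 4 * ν ^ 3 * (μ ^ 2 + μ * x + x ^ 2)
          + 3 * ν ^ 2 * (μ ^ 3 + μ ^ 2 * x + μ * x ^ 2 + x ^ 3)
          + 2 * ν * (μ ^ 4 + μ ^ 3 * x + μ ^ 2 * x ^ 2 + μ * x ^ 3 + x ^ 4)
          + (μ ^ 5 + μ ^ 4 * x + μ ^ 3 * x ^ 2 + μ ^ 2 * x ^ 3 + μ * x ^ 4 + x ^ 5))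
      - κ * (3 * ν ^ 2 + 2 * ν * (μ + x) + (μ ^ 2 + μ * x + x ^ 2)) := by
  have main : ∀ ν₀ μ₀ : ℝ, (ν₀ = 1 ∧ μ₀ = 5 / 7) ∨ (ν₀ = 112 / 100 ∧ μ₀ = 4 / 7) →
      ν₀ ≤ ν → μ₀ ≤ μ → 0 ≤ (6 * ν ^ 5 + 5 * ν ^ 4 * (μ + x) + 4 * ν ^ 3 * (μ ^ 2 + μ * x + x ^ 2)
          + 3 * ν ^ 2 * (μ ^ 3 + μ ^ 2 * x + μ * x ^ 2 + x ^ 3)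
          + 2 * ν * (μ ^ 4 + μ ^ 3 * x + μ ^ 2 * x ^ 2 + μ * x ^ 3 + x ^ 4)
          + (μ ^ 5 + μ ^ 4 * x + μ ^ 3 * x ^ 2 + μ ^ 2 * x ^ 3 + μ * x ^ 4 + x ^ 5))
      - 3.08 * (3 * ν ^ 2 + 2 * ν * (μ + x) + (μ ^ 2 + μ * x + x ^ 2)) := by
    intro ν₀ μ₀ h hν hμ
    obtain ⟨p, rfl⟩ : ∃ p, ν = ν₀ + p := ⟨ν - ν₀, by ring⟩
    obtain ⟨q, rfl⟩ : ∃ q, μ = μ₀ + q := ⟨μ - μ₀, by ring⟩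
    obtain ⟨r, rfl⟩ : ∃ r, x = μ₀ + r := ⟨x - μ₀, by ring⟩
    have hp : 0 ≤ p := by linarith
    have hq : 0 ≤ q := by linarith
    have hr : 0 ≤ r := by linarith
    rcases h with ⟨rfl, rfl⟩ | ⟨rfl, rfl⟩ <;> ring_nf <;> positivity
  have hpos : 0 ≤ 3 * ν ^ 2 + 2 * ν * (μ + x) + (μ ^ 2 + μ * x + x ^ 2) := by
    have : 0 ≤ ν := by rcases hνμ with h | h <;> linarith [h.1]
    have : 0 ≤ μ := by rcases hνμ with h | h <;> linarith [h.2]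
    have : 0 ≤ x := by linarith
    positivity
  have := mul_le_mul_of_nonneg_right hκ hpos
  rcases hνμ with h | h
  · have := main _ _ (Or.inl ⟨rfl, rfl⟩) h.1 h.2
    linarith
  · have := main _ _ (Or.inr ⟨rfl, rfl⟩) h.1 h.2
    linarith

lemma le_sum_ljPotential {κ n s a b c : ℝ} (hκ : κ ≤ 3.08) (hn : 0 < n) (hs : 0 < s)
    (ha : 0 < a) (hb : 0 < b) (hc : 0 < c) (has : a ≤ s) (hbs : b ≤ s) (hcs : c ≤ s)
    (h1 : a + b + c = s + 2 * n) (h2 : a ^ 2 + b ^ 2 + c ^ 2 = s ^ 2 + 2 * n ^ 2)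
    (hns : (1 ≤ n⁻¹ ∧ 5 / 7 ≤ s⁻¹) ∨ (112 / 100 ≤ n⁻¹ ∧ 4 / 7 ≤ s⁻¹)) :
    ljPotential κ s + 2 * ljPotential κ n ≤
      ljPotential κ a + ljPotential κ b + ljPotential κ c := by
  obtain ⟨A, hA⟩ : ∃ A, A = -6 * n⁻¹ ^ 7 + κ * (3 * n⁻¹ ^ 4) := ⟨_, rfl⟩
  obtain ⟨K, hK⟩ : ∃ K, K = n⁻¹ ^ 2 * s⁻¹ * (6 * n⁻¹ ^ 5 + 5 * n⁻¹ ^ 4 * s⁻¹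
      + 4 * n⁻¹ ^ 3 * s⁻¹ ^ 2 + 3 * n⁻¹ ^ 2 * s⁻¹ ^ 3 + 2 * n⁻¹ * s⁻¹ ^ 4 + s⁻¹ ^ 5)
      - κ * (n⁻¹ ^ 2 * s⁻¹ * (3 * n⁻¹ ^ 2 + 2 * n⁻¹ * s⁻¹ + s⁻¹ ^ 2)) := ⟨_, rfl⟩
  have key : ∀ ρ, 0 < ρ → ρ ≤ s →
      ljPotential κ n + A * (ρ - n) + K * (ρ - n) ^ 2 ≤ ljPotential κ ρ := by
    intro ρ hρ h
    have hx : s⁻¹ ≤ ρ⁻¹ := by gcongr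
    have rem := hermite_remainder_nonneg hκ hx hns
    have : 0 ≤ s - ρ := by linarith
    have hR : 0 ≤ (ρ - n) ^ 2 * (s - ρ) * (n⁻¹ ^ 2 * s⁻¹ * ρ⁻¹) := by
      have := inv_pos.2 hn
      have := inv_pos.2 hs
      have := inv_pos.2 hρ
      positivity
    have := mul_nonneg hR rem
    simp only [ljPotential]
    rw [inv_pow_three_hermite hn.ne' hs.ne' hρ.ne', inv_pow_six_hermite hn.ne' hs.ne' hρ.ne',
      hA, hK]
    linarith
  have es : ljPotential κ s = ljPotential κ n + A * (s - n) + K * (s - n) ^ 2 := by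
    simp only [ljPotential]
    rw [inv_pow_three_hermite hn.ne' hs.ne' hs.ne', inv_pow_six_hermite hn.ne' hs.ne' hs.ne',
      hA, hK]
    ring
  have := key a ha has
  have := key b hb hbs
  have := key c hc hcs
  have : (ljPotential κ n + A * (a - n) + K * (a - n) ^ 2)
      + (ljPotential κ n + A * (b - n) + K * (b - n) ^ 2)
      + (ljPotential κ n + A * (c - n) + K * (c - n) ^ 2)
      = ljPotential κ s + 2 * ljPotential κ n := by
    rw [es]
    linear_combination (A - 2 * K * n) * h1 + K * h2
  linarith

lemma cube_sum_rhombic_eq (v : ℝ) (hv : 0 ≤ v) :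
    (1 + v)⁻¹ ^ 3 + 2 * (4 * (1 + v) / ((1 + v) ^ 2 + 3)) ^ 3 - 3 =
      v ^ 2 * (288 + 528 * v + 216 * v ^ 2 - 252 * v ^ 3 - 312 * v ^ 4 - 135 * v ^ 5
        - 27 * v ^ 6 - 3 * v ^ 7) / ((1 + v) ^ 3 * ((1 + v) ^ 2 + 3) ^ 3) := by
  field_simp
  ring

lemma cube_sum_rhombic_nonneg (v : ℝ) (hv : 0 ≤ v) (hv' : v ≤ 3 / 4) :
    0 ≤ (1 + v)⁻¹ ^ 3 + 2 * (4 * (1 + v) / ((1 + v) ^ 2 + 3)) ^ 3 - 3 := by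
  rw [cube_sum_rhombic_eq v hv]
  have h (k : ℕ) : 0 ≤ v ^ k * (3 / 4 - v) := mul_nonneg (pow_nonneg hv k) (by linarith)
  have : 0 ≤ 288 + 528 * v + 216 * v ^ 2 - 252 * v ^ 3 - 312 * v ^ 4 - 135 * v ^ 5
      - 27 * v ^ 6 - 3 * v ^ 7 := by
    linarith [h 1, h 2, h 3, h 4, h 5, h 6]
  positivity

lemma tail_orbit_bound (v : ℝ) (hv : 0 ≤ v) (hv' : v ≤ 3 / 4) :
    (1 + v) ^ 3 + 2 * (4 * (1 + v) / (3 * (1 + v) ^ 2 + 1)) ^ 3 - 3 ≤ 5.5 * v ^ 2 := by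
  have e : 5.5 * v ^ 2 - ((1 + v) ^ 3 + 2 * (4 * (1 + v) / (3 * (1 + v) ^ 2 + 1)) ^ 3 - 3) =
      v ^ 2 * (64 + 96 * v + 72 * v ^ 2 + 72 * v ^ 3 - 108 * v ^ 5 - 189 / 2 * v ^ 6
        - 27 * v ^ 7) / (3 * (1 + v) ^ 2 + 1) ^ 3 := by
    field_simp
    ring
  have h (k : ℕ) : 0 ≤ v ^ k * (3 / 4 - v) := mul_nonneg (pow_nonneg hv k) (by linarith)
  have : 0 ≤ 64 + 96 * v + 72 * v ^ 2 + 72 * v ^ 3 - 108 * v ^ 5 - 189 / 2 * v ^ 6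
        - 27 * v ^ 7 := by
    linarith [hv', h 1, h 2, h 3, h 4, h 5, h 6, pow_nonneg hv 2, pow_nonneg hv 3]
  rw [← sub_nonneg, e]
  positivity

lemma sixth_sum_rhombic_ge (v : ℝ) (hv : 0 ≤ v) (hv' : v ≤ 3 / 4) :
    5 / 4 * v ^ 2 ≤ ((1 + v)⁻¹ ^ 6 + 2 * (4 * (1 + v) / ((1 + v) ^ 2 + 3)) ^ 6 - 3)
      - 3.08 * ((1 + v)⁻¹ ^ 3 + 2 * (4 * (1 + v) / ((1 + v) ^ 2 + 3)) ^ 3 - 3) := by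
  have e : ((1 + v)⁻¹ ^ 6 + 2 * (4 * (1 + v) / ((1 + v) ^ 2 + 3)) ^ 6 - 3)
      - 3.08 * ((1 + v)⁻¹ ^ 3 + 2 * (4 * (1 + v) / ((1 + v) ^ 2 + 3)) ^ 3 - 3)
      - 5 / 4 * v ^ 2 = v ^ 2 * (3026944 + 15962112 * v + 44116992 * v ^ 2
        + 75005952 * v ^ 3 + 73814016 * v ^ 4 + 20911104 * v ^ 5 - 51198528 * v ^ 6
        - 89896128 * v ^ 7 - 81428256 * v ^ 8 - 51960256 * v ^ 9 - 26900964 * v ^ 10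
        - 12475008 * v ^ 11 - 5273085 * v ^ 12 - 1918086 * v ^ 13 - 562671 * v ^ 14
        - 126768 * v ^ 15 - 20751 * v ^ 16 - 2250 * v ^ 17 - 125 * v ^ 18)
        / (100 * (1 + v) ^ 6 * ((1 + v) ^ 2 + 3) ^ 6) := by
    field_simp
    ring
  have h (k : ℕ) : 0 ≤ v ^ k * (3 / 4 - v) := mul_nonneg (pow_nonneg hv k) (by linarith)
  have : 0 ≤ 3026944 + 15962112 * v + 44116992 * v ^ 2
        + 75005952 * v ^ 3 + 73814016 * v ^ 4 + 20911104 * v ^ 5 - 51198528 * v ^ 6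
        - 89896128 * v ^ 7 - 81428256 * v ^ 8 - 51960256 * v ^ 9 - 26900964 * v ^ 10
        - 12475008 * v ^ 11 - 5273085 * v ^ 12 - 1918086 * v ^ 13 - 562671 * v ^ 14
        - 126768 * v ^ 15 - 20751 * v ^ 16 - 2250 * v ^ 17 - 125 * v ^ 18 := by
    linarith [h 1, h 2, h 3, h 4, h 5, h 6, h 7, h 8, h 9, h 10, h 11, h 12, h 13, h 14,
      h 15, h 16, h 17, pow_nonneg hv 2, pow_nonneg hv 3, pow_nonneg hv 4]
  rw [← sub_nonneg, e]
  positivity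

/-- One-variable inequality behind the optimality of the triangular lattice: the energy of the
short vectors of a rhombic lattice dominates the contribution of all longer vectors. -/
lemma rhombic_energy_gt {κ w : ℝ} (hκ0 : 0 ≤ κ) (hκ : κ ≤ 3.08) (hw : 1 < w) (hw' : w ≤ 7 / 4) :
    (κ * (w ^ 3 + 2 * (4 * w / (3 * w ^ 2 + 1)) ^ 3 - 3) + 9 / 4 * ((w + w⁻¹) / 2 - 1)) / 15 <
      (w⁻¹ ^ 6 + 2 * (4 * w / (w ^ 2 + 3)) ^ 6 - 3)
        - κ * (w⁻¹ ^ 3 + 2 * (4 * w / (w ^ 2 + 3)) ^ 3 - 3) := by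
  obtain ⟨v, rfl⟩ : ∃ v, w = 1 + v := ⟨w - 1, by ring⟩
  have hv : 0 < v := by linarith
  have hv' : v ≤ 3 / 4 := by linarith
  have h1 := mul_le_mul_of_nonneg_right hκ (cube_sum_rhombic_nonneg v hv.le hv')
  have h2 := mul_le_mul_of_nonneg_left (tail_orbit_bound v hv.le hv') hκ0
  have h3 := sixth_sum_rhombic_ge v hv.le hv'
  have h4 : (1 + v + (1 + v)⁻¹) / 2 - 1 ≤ v ^ 2 / 2 := by
    have e : v ^ 2 / 2 - ((1 + v + (1 + v)⁻¹) / 2 - 1) = v ^ 3 / (2 * (1 + v)) := by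
      field_simp
      ring
    rw [← sub_nonneg, e]
    positivity
  have h5 : κ * (5.5 * v ^ 2) ≤ 3.08 * (5.5 * v ^ 2) := by gcongr
  have h6 : 0 < v ^ 2 := by positivity
  linarith

lemma ljPotential_ge {κ r ρ : ℝ} (hκ' : κ ≤ 3.08) (hr : 0 < r) (hρ : r ≤ ρ)
    {X : ℝ} (hX : r⁻¹ ^ 3 ≤ X) (hX' : X ≤ 1.5) : X ^ 2 - 3.08 * X ≤ ljPotential κ ρ := by
  have hρ0 : 0 < ρ := hr.trans_le hρ
  have h0 : 0 ≤ ρ⁻¹ ^ 3 := by positivity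
  have h1 : ρ⁻¹ ^ 3 ≤ X := le_trans (by gcongr) hX
  have e : ljPotential κ ρ = (ρ⁻¹ ^ 3) ^ 2 - κ * ρ⁻¹ ^ 3 := by
    simp only [ljPotential]
    ring
  rw [e]
  set y := ρ⁻¹ ^ 3
  nlinarith [mul_nonneg (sub_nonneg.2 h1) (show 0 ≤ 3.08 - y - X by linarith)]

lemma ljPotential_ge_min (κ ρ : ℝ) : -(κ ^ 2 / 4) ≤ ljPotential κ ρ := by
  have e : ljPotential κ ρ = (ρ⁻¹ ^ 3 - κ / 2) ^ 2 - κ ^ 2 / 4 := by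
    simp only [ljPotential]
    ring
  rw [e]
  linarith [sq_nonneg (ρ⁻¹ ^ 3 - κ / 2)]

lemma elongated_short_vector {a b c : ℝ} (hb : 0 ≤ b) (hba : 2 * b ≤ a) (hac : a ≤ c)
    (hdet : a * c - b ^ 2 = 3 / 4) (hα : 1.74 ≤ a + c - b) : 0 < a ∧ a ≤ 0.79 := by
  have ha0 : 0 < a := by
    by_contra! h
    have : b = 0 := by linarith
    subst this
    have : a = 0 := by linarith
    subst this
    norm_num at hdet
  refine ⟨ha0, ?_⟩
  have h1 : 0 ≤ a ^ 2 + 3 / 4 - b * (a - b) - 1.74 * a := by nlinarith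
  have h2 : a ≤ 1 := by nlinarith
  by_contra! h
  by_cases h3 : a < 0.95
  · nlinarith [mul_nonneg hb (show 0 ≤ a - b by linarith)]
  · push Not at h3
    have hb2 : 0.39 ≤ b := by nlinarith
    nlinarith [mul_nonneg (sub_nonneg.2 hb2) (show 0 ≤ a - b - 0.39 by linarith)]

set_option maxHeartbeats 1000000 in
lemma elongated_energy_gt {κ a b c w : ℝ} (hκ : 3.079 ≤ κ) (hκ' : κ ≤ 3.08) (hb : 0 ≤ b)
    (hba : 2 * b ≤ a) (hac : a ≤ c) (hdet : a * c - b ^ 2 = 3 / 4) (hw : 7 / 4 ≤ w)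
    (hwa : w + w⁻¹ = 4 / 3 * (a + c - b)) :
    (κ * (w ^ 3 + 2 * (4 * w / (3 * w ^ 2 + 1)) ^ 3 - 3) + 9 / 4 * ((w + w⁻¹) / 2 - 1)) / 15 <
      ljPotential κ a + ljPotential κ c + ljPotential κ (a + c - 2 * b) - 3 * (1 - κ) := by
  have hw0 : 0 < w := by linarith
  have mono : ∀ s : ℝ, 1 ≤ s → s ≤ w → s + s⁻¹ ≤ w + w⁻¹ := by
    intro s hs hsw
    have : 0 < s := by linarith
    have e : w + w⁻¹ - (s + s⁻¹) = (w - s) * (s * w - 1) / (s * w) := by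
      field_simp
      ring
    have h1 : 0 ≤ w - s := by linarith
    have h2 : 0 ≤ s * w - 1 := by nlinarith
    rw [← sub_nonneg, e]
    positivity
  have hα : 1.74 ≤ a + c - b := by
    have := mono (7 / 4) (by norm_num) hw
    norm_num at this
    linarith
  obtain ⟨ha0, ha⟩ := elongated_short_vector hb hba hac hdet hα
  have hab : 0 ≤ b * (a - b) := mul_nonneg hb (by linarith)
  have hY : a * a⁻¹ = 1 := mul_inv_cancel₀ ha0.ne'
  have hc : c = (3 / 4 + b ^ 2) * a⁻¹ := by
    field_simp
    linarith
  have hY0 : 0 < a⁻¹ := inv_pos.2 ha0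
  have hc' : 3 / 4 * a⁻¹ ≤ c := by
    rw [hc]
    have := sq_nonneg b
    gcongr
    linarith
  have hsum : a + c - b ≤ a + 3 / 4 * a⁻¹ := by
    have : c - b = 3 / 4 * a⁻¹ - b * (a - b) * a⁻¹ := by
      rw [hc]
      linear_combination b * hY
    have := mul_nonneg hab hY0.le
    linarith
  have hν : 2 * (4 * w / (3 * w ^ 2 + 1)) ^ 3 ≤ 0.66 := by
    have h : 4 * w / (3 * w ^ 2 + 1) ≤ 0.69 := by
      rw [div_le_iff₀ (by positivity)]
      nlinarith
    have : (4 * w / (3 * w ^ 2 + 1)) ^ 3 ≤ 0.69 ^ 3 := by gcongr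
    norm_num at this ⊢
    linarith
  by_cases hcase : 5 / 7 ≤ a
  · have hw1 : w ≤ 1.81 := by
      by_contra! h
      have h1 := mono 1.81 (by norm_num) h.le
      have h2 : a + 3 / 4 * a⁻¹ ≤ 1.766 := by
        have : a + 3 / 4 * a⁻¹ - 1.766 = (a ^ 2 + 3 / 4 - 1.766 * a) * a⁻¹ := by
          linear_combination -(a - 1.766) * hY
        have : a ^ 2 + 3 / 4 - 1.766 * a ≤ 0 := by nlinarith
        nlinarith
      norm_num at h1 h2
      linarith
    have hb' : b ≤ 0.05 := by nlinarith
    have p1 := ljPotential_ge_min κ a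
    have p2 := ljPotential_ge hκ' (show (0 : ℝ) < 0.949 by norm_num)
      (show (0.949 : ℝ) ≤ c by nlinarith) (X := 1.171) (by norm_num) (by norm_num)
    have p3 := ljPotential_ge hκ' (show (0 : ℝ) < 1.69 by norm_num)
      (show (1.69 : ℝ) ≤ a + c - 2 * b by linarith) (X := 0.208) (by norm_num) (by norm_num)
    have hw3 : w ^ 3 ≤ 1.81 ^ 3 := by gcongr
    have hH : κ * (w ^ 3 + 2 * (4 * w / (3 * w ^ 2 + 1)) ^ 3 - 3) ≤ 3.08 * 3.6 := by
      have : w ^ 3 + 2 * (4 * w / (3 * w ^ 2 + 1)) ^ 3 - 3 ≤ 3.6 := by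
        norm_num at hw3 hν ⊢
        linarith
      nlinarith
    have hκ2 : κ ^ 2 ≤ 3.08 ^ 2 := by gcongr
    have hwi : w⁻¹ ≤ 1 := inv_le_one_of_one_le₀ (by linarith)
    linarith
  · push Not at hcase
    have hY1 : 7 / 5 ≤ a⁻¹ := by nlinarith
    have hwY : w ≤ 1.3 * a⁻¹ := by
      by_contra! h
      have h1 := mono (1.3 * a⁻¹) (by linarith) h.le
      have e : (1.3 * a⁻¹)⁻¹ = a / 1.3 := by
        field_simp
      rw [e] at h1
      norm_num at h1
      nlinarith
    have p2 := ljPotential_ge hκ' (show (0 : ℝ) < 1.05 by norm_num)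
      (show (1.05 : ℝ) ≤ c by linarith) (X := 0.864) (by norm_num) (by norm_num)
    have p3 := ljPotential_ge hκ' (show (0 : ℝ) < 1.05 by norm_num)
      (show (1.05 : ℝ) ≤ a + c - 2 * b by linarith) (X := 0.864) (by norm_num) (by norm_num)
    have p1 : ljPotential κ a = (a⁻¹ ^ 3) ^ 2 - κ * a⁻¹ ^ 3 := by
      simp only [ljPotential]
      ring
    have hw3 : w ^ 3 ≤ (1.3 * a⁻¹) ^ 3 := by gcongr
    have hYZ : a⁻¹ ≤ a⁻¹ ^ 3 := by nlinarith [sq_nonneg (a⁻¹ - 1)]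
    have hZ : (7 / 5 : ℝ) ^ 3 ≤ a⁻¹ ^ 3 := by gcongr
    have hwi : w⁻¹ ≤ 1 := inv_le_one_of_one_le₀ (by linarith)
    rw [p1]
    rw [mul_pow] at hw3
    set Z := a⁻¹ ^ 3
    have hH : κ * (w ^ 3 + 2 * (4 * w / (3 * w ^ 2 + 1)) ^ 3 - 3) ≤ 3.08 * (2.197 * Z - 2.34) := by
      have h1 : w ^ 3 + 2 * (4 * w / (3 * w ^ 2 + 1)) ^ 3 - 3 ≤ 2.197 * Z - 2.34 := by
        norm_num at hw3 hν ⊢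
        linarith
      have h2 : 0 ≤ 2.197 * Z - 2.34 := by
        norm_num at hZ ⊢
        linarith
      exact mul_le_mul hκ' h1 (by
        have := pow_le_pow_left₀ (by norm_num) hw 3
        have : 0 ≤ 2 * (4 * w / (3 * w ^ 2 + 1)) ^ 3 := by positivity
        linarith) (by norm_num)
    have hκZ : κ * Z ≤ 3.08 * Z := by gcongr
    have hZ2 := sq_nonneg (Z - 2.7)
    linarith

/-- Three positive numbers with the first two power sums of a triple `N (α + β cos θᵢ)`,
`α = (w + w⁻¹) / 2`, `β = (w - w⁻¹) / 2`, with angles spaced by `2π / 3`, lie in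
`[N w⁻¹, N w]`. -/
lemma mem_Icc_of_power_sums {w N x y z : ℝ} (hw : 1 ≤ w) (hN : 0 ≤ N)
    (h1 : x + y + z = 3 / 2 * (w + w⁻¹) * N)
    (h2 : x ^ 2 + y ^ 2 + z ^ 2 = (9 / 8 * (w + w⁻¹) ^ 2 - 3 / 2) * N ^ 2) :
    N * w⁻¹ ≤ x ∧ x ≤ N * w := by
  have hw0 : 0 < w := by linarith
  have hle : N * w⁻¹ ≤ N * w := by
    have := inv_le_one_of_one_le₀ hw
    gcongr
    linarith
  have hp : (x - N * w⁻¹) * (x - N * w) ≤ 0 := by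
    have e : (x - N * w⁻¹) * (x - N * w) = x ^ 2 - (w + w⁻¹) * N * x + N ^ 2 := by
      field_simp
      ring
    have hyz : y + z = 3 / 2 * (w + w⁻¹) * N - x := by linarith
    have hyz2 : y ^ 2 + z ^ 2 = (9 / 8 * (w + w⁻¹) ^ 2 - 3 / 2) * N ^ 2 - x ^ 2 := by linarith
    have hs : (y + z) ^ 2 ≤ 2 * (y ^ 2 + z ^ 2) := by nlinarith [sq_nonneg (y - z)]
    rw [hyz, hyz2] at hs
    rw [e]
    nlinarith
  constructor
  · by_contra! h
    nlinarith
  · by_contra! h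
    nlinarith

lemma rhombic_nodes {w : ℝ} (hw : 1 ≤ w) (hw' : w ≤ 7 / 4) :
    (1 ≤ 4 * w / (w ^ 2 + 3) ∧ 5 / 7 ≤ w⁻¹) ∨
      (112 / 100 ≤ 4 * w / (w ^ 2 + 3) ∧ 4 / 7 ≤ w⁻¹) := by
  have hw0 : 0 < w := by linarith
  have hpos : 0 < w ^ 2 + 3 := by positivity
  rcases le_total w (7 / 5) with h | h
  · left
    rw [le_div_iff₀ hpos, le_inv_comm₀ (by norm_num) hw0]
    constructor
    · nlinarith
    · norm_num
      linarith
  · right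
    rw [le_div_iff₀ hpos, le_inv_comm₀ (by norm_num) hw0]
    constructor
    · nlinarith
    · norm_num
      linarith

/-- The six shortest vectors of a reduced lattice other than the triangular one carry an energy
excess which dominates the contribution of all longer vectors. -/
lemma reduced_energy_gt {κ a b c w : ℝ} (hκ : 3.079 ≤ κ) (hκ' : κ ≤ 3.08) (hb : 0 ≤ b)
    (hba : 2 * b ≤ a) (hac : a ≤ c) (hdet : a * c - b ^ 2 = 3 / 4) (hw : 1 < w)
    (hwa : w + w⁻¹ = 4 / 3 * (a + c - b)) :
    (κ * (w ^ 3 + 2 * (4 * w / (3 * w ^ 2 + 1)) ^ 3 - 3) + 9 / 4 * ((w + w⁻¹) / 2 - 1)) / 15 <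
      ljPotential κ a + ljPotential κ c + ljPotential κ (a + c - 2 * b) - 3 * (1 - κ) := by
  rcases le_total (7 / 4) w with h | h
  · exact elongated_energy_gt hκ hκ' hb hba hac hdet h hwa
  have hw0 : 0 < w := by linarith
  have hwi : 0 < w⁻¹ := inv_pos.2 hw0
  have hww : w * w⁻¹ = 1 := mul_inv_cancel₀ hw0.ne'
  have s1 : a + c + (a + c - 2 * b) = 3 / 2 * (w + w⁻¹) := by
    rw [hwa]
    ring
  have s2 : a ^ 2 + c ^ 2 + (a + c - 2 * b) ^ 2 = 9 / 8 * (w + w⁻¹) ^ 2 - 3 / 2 := by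
    rw [hwa]
    linear_combination -2 * hdet
  have m1 := mem_Icc_of_power_sums hw.le zero_le_one (by rw [s1]; ring) (by rw [s2]; ring)
  have m2 := mem_Icc_of_power_sums (x := c) (y := a) (z := a + c - 2 * b) hw.le zero_le_one
    (by rw [← mul_one (_ * _), ← s1] at *; ring) (by linear_combination s2)
  have m3 := mem_Icc_of_power_sums (x := a + c - 2 * b) (y := a) (z := c) hw.le zero_le_one
    (by linear_combination s1) (by linear_combination s2)
  simp only [one_mul] at m1 m2 m3
  set n := (w + 3 * w⁻¹) / 4 with hn
  have hn0 : 0 < n := by positivity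
  have hni : n⁻¹ = 4 * w / (w ^ 2 + 3) := by
    rw [hn]
    field_simp
  have key := le_sum_ljPotential (κ := κ) (n := n) (s := w) (a := a) (b := c)
    (c := a + c - 2 * b) hκ' hn0 hw0 (hwi.trans_le m1.1) (hwi.trans_le m2.1)
    (hwi.trans_le m3.1) m1.2 m2.2 m3.2 (by rw [s1, hn]; ring)
    (by rw [s2, hn]; linear_combination (9 / 8 * 2 - 3 / 4) * hww) (by
      rw [hni]
      exact rhombic_nodes hw.le h)
  have := rhombic_energy_gt (by linarith) hκ' hw h
  simp only [ljPotential, hni] at key ⊢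
  linarith

/-- The value at `v` of the binary quadratic form `a X² + 2 b X Y + c Y²`. -/
noncomputable def binaryForm (a b c : ℝ) (v : ℤ × ℤ) : ℝ :=
  a * (v.1 : ℝ) ^ 2 + 2 * b * v.1 * v.2 + c * (v.2 : ℝ) ^ 2

/-- The rotation of order three of the triangular lattice, in lattice coordinates. -/
def hexRotation : ℤ × ℤ ≃ ℤ × ℤ where
  toFun v := (-v.1 - v.2, v.1)
  invFun v := (v.2, -v.1 - v.2)
  left_inv v := by ext <;> simp
  right_inv v := by
    ext
    · simp only; ring
    · rfl

/-- The norm form of the triangular lattice. -/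
noncomputable abbrev hexNorm : ℤ × ℤ → ℝ := binaryForm 1 (1 / 2) 1

lemma hexNorm_eq_intCast (v : ℤ × ℤ) :
    hexNorm v = ((v.1 ^ 2 + v.1 * v.2 + v.2 ^ 2 : ℤ) : ℝ) := by
  simp only [hexNorm, binaryForm]
  push_cast
  ring

lemma hexNorm_nonneg (v : ℤ × ℤ) : 0 ≤ hexNorm v := by
  simp only [hexNorm, binaryForm]
  nlinarith [sq_nonneg ((v.1 : ℝ) + v.2), sq_nonneg (v.1 : ℝ), sq_nonneg (v.2 : ℝ)]

lemma hexNorm_hexRotation (v : ℤ × ℤ) : hexNorm (hexRotation v) = hexNorm v := by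
  simp only [hexNorm, binaryForm, hexRotation, Equiv.coe_fn_mk]
  push_cast
  ring

/-- The vectors of norm one of the triangular lattice, in lattice coordinates. -/
def hexUnits : Finset (ℤ × ℤ) := {(1, 0), (-1, 0), (0, 1), (0, -1), (1, -1), (-1, 1)}

lemma hexNorm_trichotomy (v : ℤ × ℤ) : v = 0 ∨ v ∈ hexUnits ∨ 2 ≤ hexNorm v := by
  obtain ⟨m, n⟩ := v
  by_cases h : m ^ 2 + m * n + n ^ 2 ≤ 1
  · have hm : m ^ 2 ≤ 1 := by nlinarith [sq_nonneg (m + 2 * n)]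
    have hn : n ^ 2 ≤ 1 := by nlinarith [sq_nonneg (n + 2 * m)]
    have hm1 : -1 ≤ m := by nlinarith
    have hm2 : m ≤ 1 := by nlinarith
    have hn1 : -1 ≤ n := by nlinarith
    have hn2 : n ≤ 1 := by nlinarith
    interval_cases m <;> interval_cases n <;> simp_all [hexUnits]
  · right; right
    rw [hexNorm_eq_intCast]
    have : 2 ≤ m ^ 2 + m * n + n ^ 2 := by omega
    exact_mod_cast this

lemma hexNorm_box_ge {k : ℕ} {v : ℤ × ℤ} (hv : v ∈ Finset.box k) :
    3 / 4 * (k : ℝ) ^ 2 ≤ hexNorm v := by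
  rw [Int.mem_box] at hv
  have h : (k : ℝ) ^ 2 = (v.1 : ℝ) ^ 2 ∨ (k : ℝ) ^ 2 = (v.2 : ℝ) ^ 2 := by
    rcases max_choice v.1.natAbs v.2.natAbs with h | h
    · left
      rw [← hv, h, Nat.cast_natAbs]
      simp
    · right
      rw [← hv, h, Nat.cast_natAbs]
      simp
  simp only [hexNorm, binaryForm]
  rcases h with h | h <;> rw [h]
  · nlinarith [sq_nonneg ((v.1 : ℝ) + 2 * v.2)]
  · nlinarith [sq_nonneg (2 * (v.1 : ℝ) + v.2)]

lemma sum_square_hexNorm_le (M : ℕ) :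
    ∑ v ∈ Finset.Icc (-((M + 3 : ℕ) : ℤ × ℤ)) ((M + 3 : ℕ) : ℤ × ℤ), (hexNorm v)⁻¹ ^ 3 ≤
      6.4 - 128 / 27 / ((M : ℝ) + 7 / 2) ^ 4 := by
  induction M with
  | zero =>
    have h : ∑ v ∈ Finset.Icc (-((0 + 3 : ℕ) : ℤ × ℤ)) ((0 + 3 : ℕ) : ℤ × ℤ),
        ((v.1 ^ 2 + v.1 * v.2 + v.2 ^ 2 : ℤ) : ℚ)⁻¹ ^ 3 ≤ 6.4 - 128 / 27 / (7 / 2) ^ 4 := by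
      decide +kernel
    have h' := (Rat.cast_le (K := ℝ)).2 h
    simp only [hexNorm_eq_intCast]
    push_cast at h' ⊢
    norm_num at h' ⊢
    exact h'
  | succ M ih =>
    have e : Finset.Icc (-((M + 1 + 3 : ℕ) : ℤ × ℤ)) ((M + 1 + 3 : ℕ) : ℤ × ℤ) =
        (Finset.box (M + 3 + 1)).disjUnion
          (Finset.Icc (-((M + 3 : ℕ) : ℤ × ℤ)) ((M + 3 : ℕ) : ℤ × ℤ))
          (Finset.disjoint_box_succ_prod _) := by
      rw [Finset.box_succ_disjUnion, show M + 1 + 3 = (M + 3).succ by omega]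
    rw [e, Finset.sum_disjUnion]
    set k : ℝ := (M : ℝ) + 4 with hk
    have hk0 : 4 ≤ k := by
      rw [hk]
      have : (0 : ℝ) ≤ M := by positivity
      linarith
    have hbox : ∑ v ∈ Finset.box (M + 3 + 1), (hexNorm v)⁻¹ ^ 3 ≤
        (8 * k) * (3 / 4 * k ^ 2)⁻¹ ^ 3 := by
      have := Finset.sum_le_card_nsmul (Finset.box (M + 3 + 1) : Finset (ℤ × ℤ))
        (fun v => (hexNorm v)⁻¹ ^ 3) ((3 / 4 * k ^ 2)⁻¹ ^ 3) (by
          intro v hv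
          have := hexNorm_box_ge hv
          push_cast at this
          rw [show (M : ℝ) + 3 + 1 = k by rw [hk]; ring] at this
          have h0 := hexNorm_nonneg v
          have : 0 < 3 / 4 * k ^ 2 := by positivity
          gcongr)
      rw [Int.card_box (by omega), nsmul_eq_mul] at this
      push_cast at this
      rwa [show (M : ℝ) + 3 + 1 = k by rw [hk]; ring] at this
    have tele : (8 * k) * (3 / 4 * k ^ 2)⁻¹ ^ 3 ≤
        128 / 27 / (k - 1 / 2) ^ 4 - 128 / 27 / (k + 1 / 2) ^ 4 := by
      have h1 : 0 < k - 1 / 2 := by linarith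
      obtain ⟨p, hp⟩ : ∃ p, k = p + 1 / 2 := ⟨k - 1 / 2, by ring⟩
      have hp0 : 0 < p := by linarith
      have hp1 : k - 1 / 2 = p := by linarith
      have hp2 : k + 1 / 2 = p + 1 := by linarith
      have e : 128 / 27 / (k - 1 / 2) ^ 4 - 128 / 27 / (k + 1 / 2) ^ 4
          - (8 * k) * (3 / 4 * k ^ 2)⁻¹ ^ 3 =
          128 / 27 * (k ^ 5 * (4 * k ^ 3 + k) - 4 * ((k - 1 / 2) * (k + 1 / 2)) ^ 4) /
            (k ^ 5 * ((k - 1 / 2) ^ 4 * (k + 1 / 2) ^ 4)) := by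
        rw [hp1, hp2, hp]
        field_simp
        ring
      have h2 : ((k - 1 / 2) * (k + 1 / 2)) ^ 4 ≤ (k ^ 2) ^ 4 := by
        have : (k - 1 / 2) * (k + 1 / 2) ≤ k ^ 2 := by nlinarith
        gcongr
      have h3 : 0 ≤ k ^ 5 * (4 * k ^ 3 + k) - 4 * ((k - 1 / 2) * (k + 1 / 2)) ^ 4 := by
        have : 0 ≤ k ^ 6 := by positivity
        nlinarith
      rw [← sub_nonneg, e]
      positivity
    push_cast
    rw [show (M : ℝ) + 1 + 7 / 2 = k + 1 / 2 by rw [hk]; ring]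
    rw [show (M : ℝ) + 7 / 2 = k - 1 / 2 by rw [hk]; ring] at ih
    push_cast at ih
    linarith

lemma sum_hexNorm_le (s : Finset (ℤ × ℤ)) : ∑ v ∈ s, (hexNorm v)⁻¹ ^ 3 ≤ 6.4 := by
  set M := s.sup fun v => max v.1.natAbs v.2.natAbs
  have hsub : s ⊆ Finset.Icc (-((M + 3 : ℕ) : ℤ × ℤ)) ((M + 3 : ℕ) : ℤ × ℤ) := by
    intro v hv
    have h : max v.1.natAbs v.2.natAbs ≤ M :=
      Finset.le_sup (f := fun v : ℤ × ℤ => max v.1.natAbs v.2.natAbs) hv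
    simp only [Finset.mem_Icc, Prod.le_def, Prod.fst_neg, Prod.snd_neg, Prod.fst_natCast,
      Prod.snd_natCast]
    push_cast
    omega
  refine (Finset.sum_le_sum_of_subset_of_nonneg hsub ?_).trans
    ((sum_square_hexNorm_le M).trans ?_)
  · intro v _ _
    have := hexNorm_nonneg v
    positivity
  · have : (0 : ℝ) ≤ 128 / 27 / ((M : ℝ) + 7 / 2) ^ 4 := by positivity
    linarith

lemma summable_hexNorm : Summable fun v => (hexNorm v)⁻¹ ^ 3 :=
  summable_of_sum_le (fun v => by have := hexNorm_nonneg v; positivity) sum_hexNorm_le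

lemma tsum_hexNorm_le : ∑' v, (hexNorm v)⁻¹ ^ 3 ≤ 6.4 :=
  summable_hexNorm.tsum_le_of_sum_le sum_hexNorm_le

lemma binaryForm_orbit_sum (a b c : ℝ) (v : ℤ × ℤ) :
    binaryForm a b c v + binaryForm a b c (hexRotation v) +
      binaryForm a b c (hexRotation (hexRotation v)) = 2 * (a + c - b) * hexNorm v := by
  simp only [hexNorm, binaryForm, hexRotation, Equiv.coe_fn_mk]
  push_cast
  ring

lemma binaryForm_orbit_sum_sq {a b c : ℝ} (hdet : a * c - b ^ 2 = 3 / 4) (v : ℤ × ℤ) :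
    binaryForm a b c v ^ 2 + binaryForm a b c (hexRotation v) ^ 2 +
      binaryForm a b c (hexRotation (hexRotation v)) ^ 2 =
      (2 * (a + c - b) ^ 2 - 3 / 2) * hexNorm v ^ 2 := by
  simp only [hexNorm, binaryForm, hexRotation, Equiv.coe_fn_mk]
  push_cast
  linear_combination (-2 * ((v.1 : ℝ) ^ 2 + v.1 * v.2 + (v.2 : ℝ) ^ 2) ^ 2) * hdet

lemma binaryForm_mem_Icc {a b c w : ℝ} (hdet : a * c - b ^ 2 = 3 / 4) (hw : 1 ≤ w)
    (hwa : w + w⁻¹ = 4 / 3 * (a + c - b)) (v : ℤ × ℤ) :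
    hexNorm v * w⁻¹ ≤ binaryForm a b c v ∧ binaryForm a b c v ≤ hexNorm v * w := by
  refine mem_Icc_of_power_sums hw (hexNorm_nonneg v) (y := binaryForm a b c (hexRotation v))
    (z := binaryForm a b c (hexRotation (hexRotation v))) ?_ ?_
  · rw [binaryForm_orbit_sum, hwa]; ring
  · rw [binaryForm_orbit_sum_sq hdet, hwa]; ring

lemma inv_binaryForm_nonneg_le {a b c w : ℝ} (hdet : a * c - b ^ 2 = 3 / 4) (hw : 1 ≤ w)
    (hwa : w + w⁻¹ = 4 / 3 * (a + c - b)) (v : ℤ × ℤ) :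
    0 ≤ (binaryForm a b c v)⁻¹ ∧ (binaryForm a b c v)⁻¹ ≤ w * (hexNorm v)⁻¹ := by
  have h := (binaryForm_mem_Icc hdet hw hwa v).1
  have h0 := hexNorm_nonneg v
  have hw0 : 0 < w := by linarith
  rcases h0.eq_or_lt with h0 | h0
  · have := (binaryForm_mem_Icc hdet hw hwa v).2
    rw [← h0, zero_mul] at h this
    rw [← h0, le_antisymm this h]
    simp
  · have : 0 < hexNorm v * w⁻¹ := by positivity
    refine ⟨inv_nonneg.2 (this.le.trans h), ?_⟩
    calc (binaryForm a b c v)⁻¹ ≤ (hexNorm v * w⁻¹)⁻¹ := by gcongr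
      _ = w * (hexNorm v)⁻¹ := by rw [mul_inv, inv_inv, mul_comm]

lemma inv_hexNorm_le_one (v : ℤ × ℤ) : (hexNorm v)⁻¹ ≤ 1 := by
  have h := hexNorm_nonneg v
  rw [hexNorm_eq_intCast] at h ⊢
  generalize v.1 ^ 2 + v.1 * v.2 + v.2 ^ 2 = k at h
  have hk : 0 ≤ k := by exact_mod_cast h
  rcases hk.eq_or_lt with hk | hk
  · simp [← hk]
  · exact inv_le_one_of_one_le₀ (by exact_mod_cast hk)

lemma summable_binaryForm_cube {a b c w : ℝ} (hdet : a * c - b ^ 2 = 3 / 4) (hw : 1 ≤ w)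
    (hwa : w + w⁻¹ = 4 / 3 * (a + c - b)) :
    Summable fun v => (binaryForm a b c v)⁻¹ ^ 3 := by
  refine Summable.of_nonneg_of_le (fun v => ?_) (fun v => ?_) (summable_hexNorm.mul_left (w ^ 3))
  · exact pow_nonneg (inv_binaryForm_nonneg_le hdet hw hwa v).1 _
  · rw [← mul_pow]
    have := inv_binaryForm_nonneg_le hdet hw hwa v
    exact pow_le_pow_left₀ this.1 this.2 3

lemma summable_binaryForm_sixth {a b c w : ℝ} (hdet : a * c - b ^ 2 = 3 / 4) (hw : 1 ≤ w)
    (hwa : w + w⁻¹ = 4 / 3 * (a + c - b)) :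
    Summable fun v => (binaryForm a b c v)⁻¹ ^ 6 := by
  refine Summable.of_nonneg_of_le (fun v => ?_) (fun v => ?_) (summable_hexNorm.mul_left (w ^ 6))
  · exact pow_nonneg (inv_binaryForm_nonneg_le hdet hw hwa v).1 _
  · have := inv_binaryForm_nonneg_le hdet hw hwa v
    refine (pow_le_pow_left₀ this.1 this.2 6).trans ?_
    rw [mul_pow]
    refine mul_le_mul_of_nonneg_left ?_ (by positivity)
    exact pow_le_pow_of_le_one (inv_nonneg.2 (hexNorm_nonneg v)) (inv_hexNorm_le_one v)
      (by norm_num)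

lemma orbit_energy_ge {a b c w : ℝ} (hdet : a * c - b ^ 2 = 3 / 4) (hw : 1 ≤ w)
    (hwa : w + w⁻¹ = 4 / 3 * (a + c - b)) {κ : ℝ} (hκ : 0 ≤ κ) {v : ℤ × ℤ} (hv : 2 ≤ hexNorm v) :
    -(κ * (w ^ 3 + 2 * (4 * w / (3 * w ^ 2 + 1)) ^ 3 - 3) + 9 / 4 * ((w + w⁻¹) / 2 - 1)) *
        (hexNorm v)⁻¹ ^ 3 ≤
      ljPotential κ (binaryForm a b c v) + ljPotential κ (binaryForm a b c (hexRotation v)) +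
        ljPotential κ (binaryForm a b c (hexRotation (hexRotation v))) -
          3 * ljPotential κ (hexNorm v) := by
  have h1 := binaryForm_orbit_sum a b c v
  have h2 := binaryForm_orbit_sum_sq hdet v
  have hx := (binaryForm_mem_Icc hdet hw hwa v).1
  have hy := (binaryForm_mem_Icc hdet hw hwa (hexRotation v)).1
  have hz := (binaryForm_mem_Icc hdet hw hwa (hexRotation (hexRotation v))).1
  simp only [hexNorm_hexRotation] at hy hz
  generalize hexNorm v = N at *
  generalize binaryForm a b c v = x at *
  generalize binaryForm a b c (hexRotation v) = y at *
  generalize binaryForm a b c (hexRotation (hexRotation v)) = z at *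
  have hN : 0 < N := by linarith
  have hw0 : 0 < w := by linarith
  have hs : 0 < N * w⁻¹ := by positivity
  have hac : a + c - b = 3 / 4 * (w + w⁻¹) := by linarith
  rw [hac] at h1 h2
  have hww : w * w⁻¹ = 1 := mul_inv_cancel₀ hw0.ne'
  have hcube := sum_inv_cube_le (n := N * (3 * w + w⁻¹) / 4) (by positivity) hs hx hy hz
    (by rw [h1]; ring)
    (by rw [h2]; linear_combination (3 / 2 * N ^ 2) * hww)
  have e : (N * w⁻¹)⁻¹ ^ 3 + 2 * (N * (3 * w + w⁻¹) / 4)⁻¹ ^ 3 =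
      (w ^ 3 + 2 * (4 * w / (3 * w ^ 2 + 1)) ^ 3) * N⁻¹ ^ 3 := by
    field_simp
  rw [e] at hcube
  have tangent : ∀ t, 0 < t → N⁻¹ ^ 6 * (7 - 6 * (t * N⁻¹)) ≤ t⁻¹ ^ 6 := by
    intro t ht
    obtain ⟨r, hr⟩ : ∃ r, r = t * N⁻¹ := ⟨_, rfl⟩
    have hr0 : 0 < r := by rw [hr]; positivity
    have hrt : t⁻¹ = N⁻¹ * r⁻¹ := by rw [hr]; field_simp
    rw [← hr, hrt, mul_pow]
    gcongr
    rw [inv_pow, ← one_div, le_div_iff₀ (by positivity)]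
    have : 0 ≤ (r - 1) ^ 2 *
      (6 * r ^ 5 + 5 * r ^ 4 + 4 * r ^ 3 + 3 * r ^ 2 + 2 * r + 1) := by positivity
    linarith
  have hsix : N⁻¹ ^ 6 * (18 - 9 * (w + w⁻¹)) ≤ x⁻¹ ^ 6 + y⁻¹ ^ 6 + z⁻¹ ^ 6 - 3 * N⁻¹ ^ 6 := by
    have := tangent x (hs.trans_le hx)
    have := tangent y (hs.trans_le hy)
    have := tangent z (hs.trans_le hz)
    have e2 : N⁻¹ ^ 6 * (7 - 6 * (x * N⁻¹)) + N⁻¹ ^ 6 * (7 - 6 * (y * N⁻¹)) +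
        N⁻¹ ^ 6 * (7 - 6 * (z * N⁻¹)) = N⁻¹ ^ 6 * (21 - 6 * ((x + y + z) * N⁻¹)) := by ring
    have e3 : 2 * (3 / 4 * (w + w⁻¹)) * N * N⁻¹ = 3 / 2 * (w + w⁻¹) := by
      field_simp
      norm_num
    rw [h1, e3] at e2
    linarith
  have hN3 : N⁻¹ ^ 3 ≤ 1 / 8 := by
    have : N⁻¹ ≤ 1 / 2 := by
      rw [← one_div]
      gcongr
    calc N⁻¹ ^ 3 ≤ (1 / 2) ^ 3 := by gcongr
      _ = 1 / 8 := by norm_num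
  have hw2 : 2 ≤ w + w⁻¹ := by nlinarith [mul_nonneg (inv_nonneg.2 hw0.le) (sq_nonneg (w - 1))]
  have hN6 : (9 * (w + w⁻¹) - 18) * N⁻¹ ^ 6 ≤ (9 * (w + w⁻¹) - 18) * (N⁻¹ ^ 3 * (1 / 8)) := by
    rw [show N⁻¹ ^ 6 = N⁻¹ ^ 3 * N⁻¹ ^ 3 by ring]
    have : 0 ≤ 9 * (w + w⁻¹) - 18 := by linarith
    gcongr
  have hκc := mul_le_mul_of_nonneg_left hcube hκ
  simp only [ljPotential]
  linarith

lemma orbit_energy_eq {κ a b c : ℝ} {v : ℤ × ℤ} (hv : v ∈ hexUnits) :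
    ljPotential κ (binaryForm a b c v) + ljPotential κ (binaryForm a b c (hexRotation v)) +
        ljPotential κ (binaryForm a b c (hexRotation (hexRotation v))) -
          3 * ljPotential κ (hexNorm v) =
      ljPotential κ a + ljPotential κ c + ljPotential κ (a + c - 2 * b) - 3 * (1 - κ) := by
  have h1 : ljPotential κ 1 = 1 - κ := by simp [ljPotential]
  simp only [hexUnits, Finset.mem_insert, Finset.mem_singleton] at hv
  rcases hv with rfl | rfl | rfl | rfl | rfl | rfl <;>
    simp [hexNorm, binaryForm, hexRotation] <;> ring_nf <;> simp only [h1] <;> ring_nf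

lemma inv_cube_defect_nonneg {w : ℝ} (hw : 1 ≤ w) :
    0 ≤ w ^ 3 + 2 * (4 * w / (3 * w ^ 2 + 1)) ^ 3 - 3 := by
  obtain ⟨d, hd⟩ : ∃ d, w = 1 + d := ⟨w - 1, by ring⟩
  have hd0 : 0 ≤ d := by linarith
  have e : w ^ 3 + 2 * (4 * w / (3 * w ^ 2 + 1)) ^ 3 - 3 =
      ((3 * w ^ 2 + 1) ^ 3 * (w ^ 3 - 3) + 128 * w ^ 3) / (3 * w ^ 2 + 1) ^ 3 := by
    field_simp
    ring
  rw [e]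
  refine div_nonneg ?_ (by positivity)
  rw [hd]
  ring_nf
  positivity

theorem binaryForm_energy_gt {κ a b c w : ℝ} (hκ : 3.079 ≤ κ) (hκ' : κ ≤ 3.08) (hb : 0 ≤ b)
    (hba : 2 * b ≤ a) (hac : a ≤ c) (hdet : a * c - b ^ 2 = 3 / 4) (hw : 1 < w)
    (hwa : w + w⁻¹ = 4 / 3 * (a + c - b)) :
    κ * (∑' v, (binaryForm a b c v)⁻¹ ^ 3 - ∑' v, (hexNorm v)⁻¹ ^ 3) <
      ∑' v, (binaryForm a b c v)⁻¹ ^ 6 - ∑' v, (hexNorm v)⁻¹ ^ 6 := by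
  have hR3 := summable_binaryForm_cube hdet hw.le hwa
  have hR6 := summable_binaryForm_sixth hdet hw.le hwa
  have hN3 := summable_hexNorm
  have hN6 : Summable fun v => (hexNorm v)⁻¹ ^ 6 :=
    summable_binaryForm_sixth (w := 1) (by norm_num) le_rfl (by norm_num)
  have key := reduced_energy_gt hκ hκ' hb hba hac hdet hw hwa
  set E := κ * (w ^ 3 + 2 * (4 * w / (3 * w ^ 2 + 1)) ^ 3 - 3) + 9 / 4 * ((w + w⁻¹) / 2 - 1)
    with hE
  set Φ := ljPotential κ a + ljPotential κ c + ljPotential κ (a + c - 2 * b) - 3 * (1 - κ) with hΦ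
  have hE0 : 0 ≤ E := by
    have h1 := mul_nonneg (show 0 ≤ κ by linarith) (inv_cube_defect_nonneg hw.le)
    have h2 : 2 ≤ w + w⁻¹ := by
      have h3 : w * w⁻¹ = 1 := mul_inv_cancel₀ (by positivity)
      nlinarith [mul_nonneg (inv_nonneg.2 (zero_le_one.trans hw.le)) (sq_nonneg (w - 1))]
    linarith
  have hφR : Summable fun v => ljPotential κ (binaryForm a b c v) := hR6.sub (hR3.mul_left κ)
  have hφN : Summable fun v => ljPotential κ (hexNorm v) := hN6.sub (hN3.mul_left κ)
  have hφR1 : Summable fun v => ljPotential κ (binaryForm a b c (hexRotation v)) :=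
    hexRotation.summable_iff.2 hφR
  have hφR2 : Summable fun v => ljPotential κ (binaryForm a b c (hexRotation (hexRotation v))) :=
    hexRotation.summable_iff.2 hφR1
  have e1 : ∑' v, ljPotential κ (binaryForm a b c (hexRotation v)) =
      ∑' v, ljPotential κ (binaryForm a b c v) :=
    hexRotation.tsum_eq fun v => ljPotential κ (binaryForm a b c v)
  have e2 : ∑' v, ljPotential κ (binaryForm a b c (hexRotation (hexRotation v))) =
      ∑' v, ljPotential κ (binaryForm a b c v) :=
    (hexRotation.tsum_eq fun v => ljPotential κ (binaryForm a b c (hexRotation v))).trans e1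
  have hlow : HasSum (fun v => -E * (hexNorm v)⁻¹ ^ 3 + if v ∈ hexUnits then Φ + E else 0)
      (-E * ∑' v, (hexNorm v)⁻¹ ^ 3 + ∑ v ∈ hexUnits, if v ∈ hexUnits then Φ + E else 0) :=
    (hN3.hasSum.mul_left _).add (hasSum_sum_of_ne_finset_zero fun v hv => by simp [hv])
  have hup := ((hφR.hasSum.add hφR1.hasSum).add hφR2.hasSum).sub (hφN.hasSum.mul_left 3)
  have hle := hasSum_le (fun v => ?_) hlow hup
  · have hcard : ∑ v ∈ hexUnits, (if v ∈ hexUnits then Φ + E else 0) = 6 * (Φ + E) := by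
      rw [Finset.sum_congr rfl fun v hv => if_pos hv, Finset.sum_const,
        show hexUnits.card = 6 from rfl, nsmul_eq_mul]
      norm_num
    have eR : ∑' v, ljPotential κ (binaryForm a b c v) =
        ∑' v, (binaryForm a b c v)⁻¹ ^ 6 - κ * ∑' v, (binaryForm a b c v)⁻¹ ^ 3 := by
      rw [← tsum_mul_left, ← hR6.tsum_sub (hR3.mul_left κ)]
      rfl
    have eN : ∑' v, ljPotential κ (hexNorm v) =
        ∑' v, (hexNorm v)⁻¹ ^ 6 - κ * ∑' v, (hexNorm v)⁻¹ ^ 3 := by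
      rw [← tsum_mul_left, ← hN6.tsum_sub (hN3.mul_left κ)]
      rfl
    have hT := mul_le_mul_of_nonneg_left tsum_hexNorm_le hE0
    rw [hcard, e1, e2, eR, eN] at hle
    linarith
  · rcases hexNorm_trichotomy v with rfl | hv | hv
    · rw [if_neg (show (0 : ℤ × ℤ) ∉ hexUnits by decide)]
      simp [hexNorm, binaryForm, hexRotation, ljPotential]
    · have hv1 : hexNorm v = 1 := by
        rw [hexNorm_eq_intCast]
        simp only [hexUnits, Finset.mem_insert, Finset.mem_singleton] at hv
        rcases hv with rfl | rfl | rfl | rfl | rfl | rfl <;> norm_num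
      have := orbit_energy_eq (a := a) (b := b) (c := c) (κ := κ) hv
      rw [if_pos hv, this, hv1]
      simp [hΦ]
    · have hv' : v ∉ hexUnits := by
        intro h
        simp only [hexUnits, Finset.mem_insert, Finset.mem_singleton] at h
        rcases h with rfl | rfl | rfl | rfl | rfl | rfl <;> norm_num [hexNorm, binaryForm] at hv
      rw [if_neg hv', add_zero]
      exact orbit_energy_ge hdet hw.le hwa (by linarith) hv

lemma norm_sq_smul_add_smul (u v : EuclideanSpace ℝ (Fin 2)) (p : ℤ × ℤ) :
    ‖(p.1 : ℝ) • u + (p.2 : ℝ) • v‖ ^ 2 =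
      binaryForm (u 0 ^ 2 + u 1 ^ 2) (u 0 * v 0 + u 1 * v 1) (v 0 ^ 2 + v 1 ^ 2) p := by
  rw [EuclideanSpace.real_norm_sq_eq]
  simp [Fin.sum_univ_two, binaryForm]
  ring

lemma det2_smul_add_smul (u v : EuclideanSpace ℝ (Fin 2)) (a b c d : ℝ) :
    det2 (d • u + c • v) (b • u + a • v) = (a * d - b * c) * det2 u v := by
  simp [det2]
  ring

lemma injective_smul_add_smul {u v : EuclideanSpace ℝ (Fin 2)} (h : det2 u v ≠ 0) :
    Function.Injective fun p : ℤ × ℤ => (p.1 : ℝ) • u + (p.2 : ℝ) • v := by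
  rintro ⟨m, n⟩ ⟨m', n'⟩ hp
  have h0 := congrArg (fun x : EuclideanSpace ℝ (Fin 2) => x 0) hp
  have h1 := congrArg (fun x : EuclideanSpace ℝ (Fin 2) => x 1) hp
  simp at h0 h1
  have hm : ((m : ℝ) - m') * det2 u v = 0 := by
    simp only [det2]
    linear_combination v 1 * h0 - v 0 * h1
  have hn : ((n : ℝ) - n') * det2 u v = 0 := by
    simp only [det2]
    linear_combination u 0 * h1 - u 1 * h0
  have hm' := (mul_eq_zero.1 hm).resolve_right h
  have hn' := (mul_eq_zero.1 hn).resolve_right h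
  rw [sub_eq_zero] at hm' hn'
  ext <;> assumption_mod_cast

lemma epsteinZeta_latticeSet {u v : EuclideanSpace ℝ (Fin 2)} (h : det2 u v ≠ 0) {k : ℕ}
    (hk : k ≠ 0) :
    epsteinZeta (latticeSet u v) (2 * k) = ∑' p, (binaryForm (u 0 ^ 2 + u 1 ^ 2)
      (u 0 * v 0 + u 1 * v 1) (v 0 ^ 2 + v 1 ^ 2) p)⁻¹ ^ k := by
  rw [epsteinZeta, tsum_subtype (latticeSet u v \ {0}) fun p => ‖p‖ ^ (-(2 * k : ℝ)),
    ← (injective_smul_add_smul h).tsum_eq]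
  · refine tsum_congr fun p => ?_
    rw [← norm_sq_smul_add_smul]
    have hmem : (p.1 : ℝ) • u + (p.2 : ℝ) • v ∈ latticeSet u v := ⟨p.1, p.2, rfl⟩
    generalize (p.1 : ℝ) • u + (p.2 : ℝ) • v = x at *
    by_cases hx : x = 0
    · simp [hx, hk]
    · rw [Set.indicator_of_mem (show x ∈ latticeSet u v \ {0} from ⟨hmem, hx⟩),
        Real.rpow_neg (norm_nonneg _), inv_pow, ← pow_mul, ← Real.rpow_natCast]
      push_cast
      rfl
  · rintro x hx
    obtain ⟨⟨m, n, rfl⟩, -⟩ := Set.mem_of_indicator_ne_zero hx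
    exact ⟨(m, n), rfl⟩

lemma latticeSet_smul_add_smul (u v : EuclideanSpace ℝ (Fin 2)) {a b c d : ℤ}
    (h : a * d - b * c = 1) :
    latticeSet ((d : ℝ) • u + (c : ℝ) • v) ((b : ℝ) • u + (a : ℝ) • v) = latticeSet u v := by
  have h' : (a : ℝ) * d - b * c = 1 := by exact_mod_cast h
  ext p
  constructor
  · rintro ⟨m, n, rfl⟩
    refine ⟨m * d + n * b, m * c + n * a, ?_⟩
    push_cast
    module
  · rintro ⟨m, n, rfl⟩
    refine ⟨a * m - b * n, d * n - c * m, ?_⟩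
    push_cast
    calc (m : ℝ) • u + (n : ℝ) • v = ((a : ℝ) * d - b * c) • ((m : ℝ) • u + (n : ℝ) • v) := by
          rw [h', one_smul]
      _ = _ := by module

lemma latticeSet_neg_right (u v : EuclideanSpace ℝ (Fin 2)) :
    latticeSet u (-v) = latticeSet u v := by
  ext p
  constructor
  · rintro ⟨m, n, rfl⟩
    exact ⟨m, -n, by push_cast; module⟩
  · rintro ⟨m, n, rfl⟩
    exact ⟨m, -n, by push_cast; module⟩

/-- Reduction of a basis of the complex plane by the modular group. -/
lemma exists_modular_reduction {U V : ℂ} (h : 0 < (V / U).im) :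
    ∃ a b c d : ℤ, a * d - b * c = 1 ∧ 1 ≤ Complex.normSq ((a * V + b * U) / (c * V + d * U)) ∧
      |((a * V + b * U) / (c * V + d * U)).re| ≤ 1 / 2 := by
  obtain ⟨g, hg⟩ := ModularGroup.exists_smul_mem_fd ⟨V / U, h⟩
  have hU : U ≠ 0 := by rintro rfl; simp at h
  have e : ((g 0 0 : ℂ) * V + g 0 1 * U) / (g 1 0 * V + g 1 1 * U) =
      ((g • (⟨V / U, h⟩ : UpperHalfPlane) : UpperHalfPlane) : ℂ) := by
    rw [UpperHalfPlane.specialLinearGroup_apply]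
    have e1 (x y : ℤ) : (x : ℂ) * V + y * U = (x * (V / U) + y) * U := by field_simp
    rw [e1, e1, mul_div_mul_right _ _ hU]
    simp
  refine ⟨g 0 0, g 0 1, g 1 0, g 1 1, ?_, ?_, ?_⟩
  · rw [← Matrix.det_fin_two, g.2]
  · rw [e]; exact hg.1
  · rw [e]; exact hg.2

lemma exists_reduced_basis_of_det_pos {u v : EuclideanSpace ℝ (Fin 2)} (h : 0 < det2 u v) :
    ∃ u' v', latticeSet u' v' = latticeSet u v ∧ det2 u' v' = det2 u v ∧
      2 * |u' 0 * v' 0 + u' 1 * v' 1| ≤ u' 0 ^ 2 + u' 1 ^ 2 ∧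
      u' 0 ^ 2 + u' 1 ^ 2 ≤ v' 0 ^ 2 + v' 1 ^ 2 := by
  have hu : 0 < u 0 ^ 2 + u 1 ^ 2 := by
    by_contra! hu
    have h0 : u 0 = 0 := by nlinarith [sq_nonneg (u 0), sq_nonneg (u 1)]
    have h1 : u 1 = 0 := by nlinarith [sq_nonneg (u 0), sq_nonneg (u 1)]
    simp [det2, h0, h1] at h
  obtain ⟨a, b, c, d, hdet, h1, h2⟩ :=
    exists_modular_reduction (U := ⟨u 0, u 1⟩) (V := ⟨v 0, v 1⟩) (by
      have : 0 < det2 u v / (u 0 ^ 2 + u 1 ^ 2) := by positivity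
      convert this using 1
      simp [Complex.div_im, Complex.normSq_apply, det2]
      ring)
  have hdet' : (a : ℝ) * d - b * c = 1 := by exact_mod_cast hdet
  set u' := (d : ℝ) • u + (c : ℝ) • v with hu'
  set v' := (b : ℝ) • u + (a : ℝ) • v with hv'
  have hd : det2 u' v' = det2 u v := by
    rw [hu', hv', det2_smul_add_smul, hdet', one_mul]
  have eU : (c * ⟨v 0, v 1⟩ + d * ⟨u 0, u 1⟩ : ℂ) = ⟨u' 0, u' 1⟩ := by
    apply Complex.ext <;> simp [hu'] <;> ring
  have eV : (a * ⟨v 0, v 1⟩ + b * ⟨u 0, u 1⟩ : ℂ) = ⟨v' 0, v' 1⟩ := by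
    apply Complex.ext <;> simp [hv'] <;> ring
  have hpos : 0 < u' 0 ^ 2 + u' 1 ^ 2 := by
    by_contra! hu
    have h0 : u' 0 = 0 := by nlinarith [sq_nonneg (u' 0), sq_nonneg (u' 1)]
    have h1 : u' 1 = 0 := by nlinarith [sq_nonneg (u' 0), sq_nonneg (u' 1)]
    simp [det2, h0, h1] at hd
    simp [det2] at h
    linarith
  rw [eU, eV] at h1 h2
  refine ⟨u', v', latticeSet_smul_add_smul u v hdet, hd, ?_, ?_⟩
  · rw [show ((⟨v' 0, v' 1⟩ : ℂ) / ⟨u' 0, u' 1⟩).re =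
        (u' 0 * v' 0 + u' 1 * v' 1) / (u' 0 ^ 2 + u' 1 ^ 2) by
      simp [Complex.div_re, Complex.normSq_apply]; ring, abs_div, abs_of_pos hpos,
      div_le_iff₀ hpos] at h2
    linarith
  · rw [Complex.normSq_div, Complex.normSq_mk, Complex.normSq_mk, le_div_iff₀ (by nlinarith)] at h1
    linarith

lemma exists_reduced_basis {u v : EuclideanSpace ℝ (Fin 2)} (h : det2 u v ≠ 0) :
    ∃ u' v', latticeSet u' v' = latticeSet u v ∧ |det2 u' v'| = |det2 u v| ∧
      0 ≤ u' 0 * v' 0 + u' 1 * v' 1 ∧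
      2 * (u' 0 * v' 0 + u' 1 * v' 1) ≤ u' 0 ^ 2 + u' 1 ^ 2 ∧
      u' 0 ^ 2 + u' 1 ^ 2 ≤ v' 0 ^ 2 + v' 1 ^ 2 := by
  have hneg : ∀ u v, det2 u (-v) = -det2 u v := by
    intro u v
    simp [det2]
    ring
  obtain ⟨u', v', hL, hd, h1, h2⟩ : ∃ u' v', latticeSet u' v' = latticeSet u v ∧
      |det2 u' v'| = |det2 u v| ∧ 2 * |u' 0 * v' 0 + u' 1 * v' 1| ≤ u' 0 ^ 2 + u' 1 ^ 2 ∧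
      u' 0 ^ 2 + u' 1 ^ 2 ≤ v' 0 ^ 2 + v' 1 ^ 2 := by
    rcases h.lt_or_gt with h | h
    · obtain ⟨u', v', hL, hd, h12⟩ :=
        exists_reduced_basis_of_det_pos (u := u) (v := -v) (by rw [hneg]; linarith)
      exact ⟨u', v', hL.trans (latticeSet_neg_right u v), by rw [hd, hneg, abs_neg], h12⟩
    · obtain ⟨u', v', hL, hd, h12⟩ := exists_reduced_basis_of_det_pos h
      exact ⟨u', v', hL, by rw [hd], h12⟩
  rcases le_total 0 (u' 0 * v' 0 + u' 1 * v' 1) with h0 | h0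
  · rw [abs_of_nonneg h0] at h1
    exact ⟨u', v', hL, hd, h0, h1, h2⟩
  · rw [abs_of_nonpos h0] at h1
    refine ⟨u', -v', (latticeSet_neg_right u' v').trans hL, by rw [hneg, abs_neg, hd], ?_, ?_, ?_⟩
      <;> simp <;> linarith

/-- The linear isometry of the plane sending the standard basis to an orthonormal pair. -/
lemma exists_linearIsometryEquiv {e f : EuclideanSpace ℝ (Fin 2)} (he : e 0 ^ 2 + e 1 ^ 2 = 1)
    (hf : f 0 ^ 2 + f 1 ^ 2 = 1) (hef : e 0 * f 0 + e 1 * f 1 = 0) :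
    ∃ O : EuclideanSpace ℝ (Fin 2) ≃ₗᵢ[ℝ] EuclideanSpace ℝ (Fin 2),
      ∀ x, O x = x 0 • e + x 1 • f := by
  let T : EuclideanSpace ℝ (Fin 2) →ₗᵢ[ℝ] EuclideanSpace ℝ (Fin 2) :=
    { toFun := fun x => x 0 • e + x 1 • f
      map_add' := fun x y => by simp only [PiLp.add_apply]; module
      map_smul' := fun r x => by simp only [PiLp.smul_apply, smul_eq_mul, RingHom.id_apply]; module
      norm_map' := fun x => by
        rw [← sq_eq_sq₀ (norm_nonneg _) (norm_nonneg _), EuclideanSpace.real_norm_sq_eq,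
          EuclideanSpace.real_norm_sq_eq]
        simp [Fin.sum_univ_two]
        linear_combination x 0 ^ 2 * he + x 1 ^ 2 * hf + 2 * x 0 * x 1 * hef }
  exact ⟨T.toLinearIsometryEquiv rfl, fun x => rfl⟩

lemma image_latticeSet (O : EuclideanSpace ℝ (Fin 2) ≃ₗᵢ[ℝ] EuclideanSpace ℝ (Fin 2))
    (u v : EuclideanSpace ℝ (Fin 2)) : O '' latticeSet u v = latticeSet (O u) (O v) := by
  ext p
  constructor
  · rintro ⟨_, ⟨m, n, rfl⟩, rfl⟩
    exact ⟨m, n, by simp⟩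
  · rintro ⟨m, n, rfl⟩
    exact ⟨_, ⟨m, n, rfl⟩, by simp⟩

lemma isRotationOf_triangularLattice {u v : EuclideanSpace ℝ (Fin 2)}
    (hu : u 0 ^ 2 + u 1 ^ 2 = 2 / √3) (huv : u 0 * v 0 + u 1 * v 1 = 1 / √3)
    (hv : v 0 ^ 2 + v 1 ^ 2 = 2 / √3) : IsRotationOf (latticeSet u v) triangularLattice := by
  have h3 : √3 ^ 2 = 3 := Real.sq_sqrt (by norm_num)
  have h30 : 0 < √3 := by positivity
  obtain ⟨r, hr⟩ : ∃ r, r = √(2 / √3) := ⟨_, rfl⟩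
  have hr0 : 0 < r := by rw [hr]; positivity
  have hr2 : r ^ 2 = 2 / √3 := by rw [hr]; exact Real.sq_sqrt (by positivity)
  obtain ⟨O, hO⟩ := exists_linearIsometryEquiv (e := r⁻¹ • u)
    (f := (2 / √3 * r⁻¹) • v - (1 / √3 * r⁻¹) • u) (by
      simp
      field_simp
      rw [hu, hr2]) (by
      simp
      field_simp
      rw [hr2, h3]
      linear_combination 4 * hv + hu - 4 * huv) (by
      simp
      field_simp
      linear_combination 2 * huv - hu)
  refine ⟨O, ?_⟩
  rw [triangularLattice, image_latticeSet, ← hr, hO, hO]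
  congr 1
  · simp [vec2, smul_smul, hr0.ne']
  · have e1 : (r • vec2 (1 / 2) (√3 / 2)) 0 = r * (1 / 2) := by simp [vec2]
    have e2 : (r • vec2 (1 / 2) (√3 / 2)) 1 = r * (√3 / 2) := by simp [vec2]
    rw [e1, e2]
    match_scalars <;> field_simp
    norm_num

lemma epsteinZeta_scaled {u v : EuclideanSpace ℝ (Fin 2)} {a b c : ℝ} (h : det2 u v ≠ 0)
    (hA : u 0 ^ 2 + u 1 ^ 2 = 2 / √3 * a) (hB : u 0 * v 0 + u 1 * v 1 = 2 / √3 * b)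
    (hC : v 0 ^ 2 + v 1 ^ 2 = 2 / √3 * c) :
    epsteinZeta (latticeSet u v) 12 = 27 / 64 * ∑' p, (binaryForm a b c p)⁻¹ ^ 6 ∧
      epsteinZeta (latticeSet u v) 6 = 3 * √3 / 8 * ∑' p, (binaryForm a b c p)⁻¹ ^ 3 := by
  have h3 : √3 ^ 2 = 3 := Real.sq_sqrt (by norm_num)
  have e (p : ℤ × ℤ) : (binaryForm (2 / √3 * a) (2 / √3 * b) (2 / √3 * c) p)⁻¹ =
      √3 / 2 * (binaryForm a b c p)⁻¹ := by
    rw [← inv_div 2 √3, ← mul_inv]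
    congr 1
    simp only [binaryForm]
    ring
  have e12 := epsteinZeta_latticeSet h (k := 6) (by norm_num)
  have e6 := epsteinZeta_latticeSet h (k := 3) (by norm_num)
  simp only [hA, hB, hC, e, mul_pow, tsum_mul_left] at e12 e6
  rw [show (√3 / 2) ^ 6 = (√3 ^ 2) ^ 3 / 64 by ring, h3] at e12
  rw [show (√3 / 2) ^ 3 = √3 ^ 2 * √3 / 8 by ring, h3] at e6
  norm_num at e12 e6 ⊢
  exact ⟨e12, e6⟩

/-- For every unit co-volume lattice `L` which is not a rotation of `A₂`, one has
`ζ_L(12) - ζ_{A₂}(12) > 2(ζ_L(6) - ζ_{A₂}(6))`, i.e. `Q_{12,6}(L) > 2`. -/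
theorem quotient_12_6_gt_two
    (L : Set (EuclideanSpace ℝ (Fin 2))) (hL : IsLattice2OfCovol L 1)
    (hne : ¬ IsRotationOf L triangularLattice) :
    epsteinZeta L 12 - epsteinZeta triangularLattice 12 >
      2 * (epsteinZeta L 6 - epsteinZeta triangularLattice 6) := by
  obtain ⟨u₀, v₀, hdet₀, hdet₁, rfl⟩ := hL
  obtain ⟨u, v, hL, hdet, hb, hba, hac⟩ := exists_reduced_basis hdet₀
  rw [← hL] at hne ⊢
  rw [hdet₁] at hdet
  have h3 : √3 ^ 2 = 3 := Real.sq_sqrt (by norm_num)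
  have h30 : 0 < √3 := by positivity
  have scale (x : ℝ) : ∃ y, x = 2 / √3 * y := ⟨x * (√3 / 2), by field_simp⟩
  obtain ⟨a, ha⟩ := scale (u 0 ^ 2 + u 1 ^ 2)
  obtain ⟨b, hb'⟩ := scale (u 0 * v 0 + u 1 * v 1)
  obtain ⟨c, hc⟩ := scale (v 0 ^ 2 + v 1 ^ 2)
  have ht : 0 < 2 / √3 := by positivity
  have hgram : a * c - b ^ 2 = 3 / 4 := by
    have h1 : (u 0 ^ 2 + u 1 ^ 2) * (v 0 ^ 2 + v 1 ^ 2) - (u 0 * v 0 + u 1 * v 1) ^ 2 = 1 := by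
      have h2 := sq_abs (det2 u v)
      rw [hdet, det2] at h2
      linear_combination -h2
    have h2 : (2 / √3) ^ 2 = 4 / 3 := by rw [div_pow, h3]; norm_num
    rw [ha, hb', hc] at h1
    linear_combination 3 / 4 * h1 - 3 / 4 * (a * c - b ^ 2) * h2
  have hb0 : 0 ≤ b := by
    rw [hb'] at hb
    exact nonneg_of_mul_nonneg_right hb ht
  have hba0 : 2 * b ≤ a := by
    rw [hb', ha] at hba
    refine le_of_mul_le_mul_left ?_ ht
    linarith
  have hac0 : a ≤ c := by
    rw [ha, hc] at hac
    exact le_of_mul_le_mul_left hac ht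
  have hα : 3 / 2 < a + c - b := by
    by_contra! h
    have hb1 : b = 1 / 2 := by
      nlinarith
    have ha1 : a = 1 := by nlinarith
    have hc1 : c = 1 := by nlinarith
    refine hne (isRotationOf_triangularLattice ?_ ?_ ?_)
    · rw [ha, ha1, mul_one]
    · rw [hb', hb1]; ring
    · rw [hc, hc1, mul_one]
  obtain ⟨w, hw, hwa⟩ : ∃ w : ℝ, 1 < w ∧ w + w⁻¹ = 4 / 3 * (a + c - b) := by
    obtain ⟨α, hα'⟩ : ∃ α, α = 2 / 3 * (a + c - b) := ⟨_, rfl⟩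
    have hα1 : 1 < α := by linarith
    have hs : √(α ^ 2 - 1) ^ 2 = α ^ 2 - 1 := Real.sq_sqrt (by nlinarith)
    have hs0 := Real.sqrt_nonneg (α ^ 2 - 1)
    refine ⟨α + √(α ^ 2 - 1), by linarith, ?_⟩
    rw [inv_eq_of_mul_eq_one_right (show (α + √(α ^ 2 - 1)) * (α - √(α ^ 2 - 1)) = 1 by
      linear_combination -hs)]
    linarith
  have hlt : 1.732 < √3 := by
    rw [Real.lt_sqrt (by norm_num)]; norm_num
  have hgt : √3 < 1.7321 := by
    rw [Real.sqrt_lt' (by norm_num)]; norm_num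
  have key := binaryForm_energy_gt (κ := 16 * √3 / 9) (by linarith) (by linarith)
    hb0 hba0 hac0 hgram hw hwa
  obtain ⟨r, hr⟩ : ∃ r, r = √(2 / √3) := ⟨_, rfl⟩
  have hr0 : 0 < r := by rw [hr]; positivity
  have hr2 : r ^ 2 = 2 / √3 := by rw [hr]; exact Real.sq_sqrt ht.le
  have hdetL : det2 u v ≠ 0 := by
    intro h
    simp [h] at hdet
  obtain ⟨e1, e2⟩ := epsteinZeta_scaled hdetL ha hb' hc
  obtain ⟨e3, e4⟩ := epsteinZeta_scaled (u := r • vec2 1 0) (v := r • vec2 (1 / 2) (√3 / 2))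
    (a := 1) (b := 1 / 2) (c := 1) (by simp [det2, vec2, hr0.ne']) (by simp [vec2, hr2]) (by
      simp [vec2]
      linear_combination hr2 / 2) (by
      simp [vec2]
      linear_combination (1 / 4 + √3 ^ 2 / 4) * hr2 + 2 / √3 / 4 * h3)
  rw [triangularLattice, ← hr, e1, e2, e3, e4]
  linarith
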